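/- arXiv:2012.12731 — 2 statements merged into one kernel-verified Lean document; each statement's English description precedes it below -/
import Mathlib

section
/- Let p > 2, let p' = p/(p-1), let k_p = min{k ∈ ℕ : k ≥ p}, and for α > 0, t ∈ ℝ set S_{k_p-2}(α,t) = Σ_{k=0}^{k_p-2} (α^k/k!)|t|^{p'k} and R(α,t) = exp(α|t|^{p'}) − S_{k_p-2}(α,t). Then for every α > 0, every r > 1 and every β > r, there exists a constant C_β > 0 such that (exp(α|t|^{p'}) − S_{k_p-2}(α,t))^r ≤ C_β (exp(βα|t|^{p'}) − S_{k_p-2}(βα,t)) for all t ∈ ℝ. -/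
/-- The exponential with its first `m` Taylor terms removed is the sum of the remaining ones. -/
theorem hasSum_exp_sub_sum_range (m : ℕ) (x : ℝ) :
    HasSum (fun k : ℕ => x ^ (k + m) / (Nat.factorial (k + m)))
      (Real.exp x - ∑ k ∈ Finset.range m, x ^ k / (Nat.factorial k)) := by
  have h : HasSum (fun k : ℕ => x ^ k / (Nat.factorial k)) (Real.exp x) := by
    rw [Real.exp_eq_exp_ℝ]
    exact NormedSpace.expSeries_div_hasSum_exp x
  exact (hasSum_nat_add_iff' m).2 h

theorem exp_sub_sum_range_nonneg (m : ℕ) {x : ℝ} (hx : 0 ≤ x) :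
    0 ≤ Real.exp x - ∑ k ∈ Finset.range m, x ^ k / (Nat.factorial k) :=
  (hasSum_exp_sub_sum_range m x).nonneg fun k => by positivity

theorem exp_sub_sum_range_le_exp (m : ℕ) {x : ℝ} (hx : 0 ≤ x) :
    Real.exp x - ∑ k ∈ Finset.range m, x ^ k / (Nat.factorial k) ≤ Real.exp x :=
  sub_le_self _ (Finset.sum_nonneg fun k _ => by positivity)

theorem exp_sub_sum_range_mono (m : ℕ) {x y : ℝ} (hx : 0 ≤ x) (hxy : x ≤ y) :
    Real.exp x - ∑ k ∈ Finset.range m, x ^ k / (Nat.factorial k) ≤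
      Real.exp y - ∑ k ∈ Finset.range m, y ^ k / (Nat.factorial k) :=
  hasSum_le (fun k => by gcongr) (hasSum_exp_sub_sum_range m x) (hasSum_exp_sub_sum_range m y)

theorem pow_div_factorial_le_exp_sub_sum_range (m : ℕ) {x : ℝ} (hx : 0 ≤ x) :
    x ^ m / (Nat.factorial m) ≤
      Real.exp x - ∑ k ∈ Finset.range m, x ^ k / (Nat.factorial k) := by
  simpa using le_hasSum (hasSum_exp_sub_sum_range m x) 0 fun k _ => by positivity

/-- Away from the origin, the truncated exponential is comparable with the exponential. -/
theorem exp_le_mul_exp_sub_sum_range (m : ℕ) {x : ℝ} (hx : 1 ≤ x) :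
    Real.exp x ≤ (1 + m * Nat.factorial m) *
      (Real.exp x - ∑ k ∈ Finset.range m, x ^ k / (Nat.factorial k)) := by
  have hx0 : 0 ≤ x := zero_le_one.trans hx
  have hsum : ∑ k ∈ Finset.range m, x ^ k / (Nat.factorial k) ≤ m * x ^ m := by
    calc ∑ k ∈ Finset.range m, x ^ k / (Nat.factorial k)
        ≤ ∑ _k ∈ Finset.range m, x ^ m := by
          refine Finset.sum_le_sum fun k hk => ?_
          have h1 : (1 : ℝ) ≤ Nat.factorial k := by
            exact_mod_cast Nat.one_le_iff_ne_zero.2 k.factorial_ne_zero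
          exact (div_le_self (by positivity) h1).trans
            (pow_le_pow_right₀ hx (Finset.mem_range.1 hk).le)
      _ = m * x ^ m := by simp
  have hpow := pow_div_factorial_le_exp_sub_sum_range m hx0
  rw [div_le_iff₀ (by positivity)] at hpow
  have := mul_le_mul_of_nonneg_left hpow (Nat.cast_nonneg (α := ℝ) m)
  linarith

theorem rpow_exp_sub_sum_range_le (m : ℕ) {r β x : ℝ} (hr : 1 < r) (hβ : r < β) (hx : 0 ≤ x) :
    (Real.exp x - ∑ k ∈ Finset.range m, x ^ k / (Nat.factorial k)) ^ r ≤
      (Real.exp 1 ^ (r - 1) + (1 + m * Nat.factorial m)) *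
        (Real.exp (β * x) - ∑ k ∈ Finset.range m, (β * x) ^ k / (Nat.factorial k)) := by
  have hβ1 : 1 ≤ β := (hr.trans hβ).le
  have hxβ : x ≤ β * x := le_mul_of_one_le_left hx hβ1
  have hE := exp_sub_sum_range_nonneg m hx
  have hEle := exp_sub_sum_range_le_exp m hx
  have hmono := exp_sub_sum_range_mono m hx hxβ
  have hEβ := hE.trans hmono
  rw [add_mul]
  rcases le_total x 1 with hx1 | hx1
  · refine le_add_of_le_of_nonneg ?_ (by positivity)
    calc _ = (Real.exp x - ∑ k ∈ Finset.range m, x ^ k / (Nat.factorial k)) ^ (r - 1) *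
          (Real.exp x - ∑ k ∈ Finset.range m, x ^ k / (Nat.factorial k)) := by
          rw [← Real.rpow_add_one' hE (by linarith), sub_add_cancel]
      _ ≤ _ := by
          refine mul_le_mul (Real.rpow_le_rpow hE ?_ (by linarith)) hmono hE (by positivity)
          exact hEle.trans (Real.exp_le_exp.2 hx1)
  · refine le_add_of_nonneg_of_le (by positivity) ?_
    refine le_trans ?_ (exp_le_mul_exp_sub_sum_range m (hx1.trans hxβ))
    calc _ ≤ Real.exp x ^ r := Real.rpow_le_rpow hE hEle (by linarith)
      _ = Real.exp (x * r) := (Real.exp_mul x r).symm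
      _ ≤ Real.exp (β * x) := by
          rw [mul_comm x r]
          gcongr

/-- Lemma on powers of the truncated exponential, cf. Lemma 2.3 of the paper.
For `p > 2`, `p' = p/(p-1)`, `k_p = ⌈p⌉` (the least natural number `≥ p`), and
`S_{k_p-2}(α,t) = ∑_{k=0}^{k_p-2} (α^k/k!)|t|^{p'k}`, for every `α > 0`, `r > 1` and `β > r`
there is `C_β > 0` with
`(exp(α|t|^{p'}) − S_{k_p-2}(α,t))^r ≤ C_β (exp(βα|t|^{p'}) − S_{k_p-2}(βα,t))` for all `t`. -/
theorem stmt_0 (p : ℝ) (hp : 2 < p) (α r β : ℝ) (hα : 0 < α) (hr : 1 < r) (hβ : r < β) :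
    ∃ C : ℝ, 0 < C ∧ ∀ t : ℝ,
      (Real.exp (α * |t| ^ (p / (p - 1))) -
          ∑ k ∈ Finset.range (⌈p⌉₊ - 1), α ^ k / (Nat.factorial k) * |t| ^ (p / (p - 1) * k)) ^ r
        ≤ C * (Real.exp (β * α * |t| ^ (p / (p - 1))) -
          ∑ k ∈ Finset.range (⌈p⌉₊ - 1),
            (β * α) ^ k / (Nat.factorial k) * |t| ^ (p / (p - 1) * k)) := by
  have hterm : ∀ (a t : ℝ) (k : ℕ), a ^ k / (Nat.factorial k) * |t| ^ (p / (p - 1) * k) =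
      (a * |t| ^ (p / (p - 1))) ^ k / (Nat.factorial k) := fun a t k => by
    rw [Real.rpow_mul_natCast (abs_nonneg t), mul_pow]
    ring
  refine ⟨Real.exp 1 ^ (r - 1) + (1 + (⌈p⌉₊ - 1 : ℕ) * Nat.factorial (⌈p⌉₊ - 1)),
    by positivity, fun t => ?_⟩
  simp only [hterm, mul_assoc β α]
  exact rpow_exp_sub_sum_range_le (⌈p⌉₊ - 1) hr hβ (by positivity)
end

section
/- Let N be a positive integer and p > 2. Let (u_n) and u be measurable functions on ℝ^N such that for every R > 0, u_n → u in L^p(B_R). Then liminf_{n→∞} ∫_{ℝ^N}∫_{ℝ^N} ln(1+|x−y|)|u_n(x)|^p |u_n(y)|^p dx dy ≥ ∫_{ℝ^N}∫_{ℝ^N} ln(1+|x−y|)|u(x)|^p |u(y)|^p dx dy, where both sides are understood as values in [0, ∞]. -/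
open MeasureTheory Filter

/-- Fatou's lemma for a double integral along a sequence converging in measure. -/
theorem lintegral_prod_kernel_le_liminf_of_tendstoInMeasure {X : Type*} [MeasurableSpace X]
    {μ : Measure X} [SFinite μ] {Φ : X × X → ℝ → ℝ → ENNReal}
    (hΦ_cont : ∀ z, Continuous fun q : ℝ × ℝ => Φ z q.1 q.2)
    {v : ℕ → X → ℝ} {w : X → ℝ}
    (hΦ_meas : ∀ n, Measurable fun z : X × X => Φ z (v n z.1) (v n z.2))
    (h : TendstoInMeasure μ v atTop w) :
    ∫⁻ z, Φ z (w z.1) (w z.2) ∂(μ.prod μ)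
      ≤ atTop.liminf fun n => ∫⁻ z, Φ z (v n z.1) (v n z.2) ∂(μ.prod μ) := by
  obtain ⟨φ, hφ_lim, hφ⟩ := exists_seq_tendsto_liminf
    (f := atTop) (u := fun n => ∫⁻ z, Φ z (v n z.1) (v n z.2) ∂(μ.prod μ))
  obtain ⟨ψ, hψ, hψ_ae⟩ :=
    TendstoInMeasure.exists_seq_tendsto_ae (f := fun n => v (φ n)) (h.comp hφ)
  rw [← (hφ_lim.comp hψ.tendsto_atTop).liminf_eq]
  refine le_trans (lintegral_mono_ae ?_)
    (lintegral_liminf_le fun k => hΦ_meas (φ (ψ k)))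
  filter_upwards [Measure.quasiMeasurePreserving_fst.ae hψ_ae,
    Measure.quasiMeasurePreserving_snd.ae hψ_ae] with z h₁ h₂
  exact (((hΦ_cont z).tendsto (w z.1, w z.2)).comp (h₁.prodMk_nhds h₂)).liminf_eq.ge

/-- Lemma 2.9(i) of the paper: lower semicontinuity of `V₁`.
If `u_n → u` in `L^p(B_R)` for every `R > 0`, then
`liminf_n ∫∫ ln(1+|x−y|)|u_n(x)|^p|u_n(y)|^p dx dy ≥ ∫∫ ln(1+|x−y|)|u(x)|^p|u(y)|^p dx dy`,
both sides understood in `[0,∞]`. -/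
theorem stmt_12 (N : ℕ) (hN : 0 < N) (p : ℝ) (hp : 2 < p)
    (un : ℕ → EuclideanSpace ℝ (Fin N) → ℝ) (u : EuclideanSpace ℝ (Fin N) → ℝ)
    (hmun : ∀ n, Measurable (un n)) (hmu : Measurable u)
    (hconv : ∀ R : ℝ, 0 < R →
      Tendsto (fun n => eLpNorm (fun x => un n x - u x) (ENNReal.ofReal p)
        (volume.restrict (Metric.ball (0 : EuclideanSpace ℝ (Fin N)) R))) atTop (nhds 0)) :
    (∫⁻ x, ∫⁻ y, ENNReal.ofReal (Real.log (1 + ‖x - y‖) * |u x| ^ p * |u y| ^ p))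
      ≤ Filter.atTop.liminf (fun n =>
          ∫⁻ x, ∫⁻ y, ENNReal.ofReal (Real.log (1 + ‖x - y‖) * |un n x| ^ p * |un n y| ^ p)) := by
  have hp0 : 0 ≤ p := by linarith
  let Φ : EuclideanSpace ℝ (Fin N) × EuclideanSpace ℝ (Fin N) → ℝ → ℝ → ENNReal :=
    fun z a b => ENNReal.ofReal (Real.log (1 + ‖z.1 - z.2‖) * |a| ^ p * |b| ^ p)
  have hΦ_cont (z) : Continuous fun q : ℝ × ℝ => Φ z q.1 q.2 :=
    ENNReal.continuous_ofReal.comp <|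
      (continuous_const.mul (continuous_fst.abs.rpow_const fun _ => Or.inr hp0)).mul
        (continuous_snd.abs.rpow_const fun _ => Or.inr hp0)
  have hΦ_meas {f : EuclideanSpace ℝ (Fin N) → ℝ} (hf : Measurable f) :
      Measurable fun z : EuclideanSpace ℝ (Fin N) × EuclideanSpace ℝ (Fin N) =>
        Φ z (f z.1) (f z.2) := by
    dsimp only [Φ]
    fun_prop
  have h_prod {f : EuclideanSpace ℝ (Fin N) → ℝ} (hf : Measurable f) :
      ∫⁻ x, ∫⁻ y, ENNReal.ofReal (Real.log (1 + ‖x - y‖) * |f x| ^ p * |f y| ^ p)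
        = ∫⁻ z, Φ z (f z.1) (f z.2) ∂(volume.prod volume) :=
    (lintegral_prod _ (hΦ_meas hf).aemeasurable).symm
  simp only [h_prod hmu, h_prod (hmun _)]
  let B (k : ℕ) : Set (EuclideanSpace ℝ (Fin N)) := Metric.ball 0 (k + 1)
  have hB_mono : Monotone B := fun i j hij => Metric.ball_subset_ball (by gcongr)
  have hB_prod : Monotone fun k => B k ×ˢ B k := fun i j hij =>
    Set.prod_mono (hB_mono hij) (hB_mono hij)
  have hB_univ : ⋃ k, B k ×ˢ B k = Set.univ := by
    refine Set.eq_univ_of_forall fun z => Set.mem_iUnion.2 ?_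
    obtain ⟨k, hk⟩ := exists_nat_ge (max ‖z.1‖ ‖z.2‖)
    refine ⟨k, mem_ball_zero_iff.2 ?_, mem_ball_zero_iff.2 ?_⟩
    · linarith [le_max_left ‖z.1‖ ‖z.2‖]
    · linarith [le_max_right ‖z.1‖ ‖z.2‖]
  rw [← setLIntegral_univ (fun z => Φ z (u z.1) (u z.2)), ← hB_univ,
    setLIntegral_iUnion_of_directed _ hB_prod.directed_le]
  refine iSup_le fun k => ?_
  have h_meas : TendstoInMeasure (volume.restrict (B k)) un atTop u :=
    tendstoInMeasure_of_tendsto_eLpNorm (by simp; linarith)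
      (fun n => (hmun n).aestronglyMeasurable) hmu.aestronglyMeasurable
      (hconv (k + 1) (by positivity))
  have h_loc := lintegral_prod_kernel_le_liminf_of_tendstoInMeasure hΦ_cont
    (fun n => hΦ_meas (hmun n)) h_meas
  rw [Measure.prod_restrict] at h_loc
  exact h_loc.trans (liminf_le_liminf (Eventually.of_forall fun n => setLIntegral_le_lintegral _ _))
end
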